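/- Let d ≥ 1, T > 0, ε > 0, and let 𝔤 ∈ C¹(ℝ^d × ℝ; ℝ^d). Let u, v be bounded C² classical solutions of ∂_t w + div_x ( 𝔤(x, w(t,x)) ) = ε Δ_x w on (0,T) × ℝ^d, continuous on [0,T] × ℝ^d, with initial data u(0,·) = u₀ and v(0,·) = v₀. Assume additionally that u − v, the spatial gradient ∇_x(u − v), and (t,x) ↦ 𝔤(x,u(t,x)) − 𝔤(x,v(t,x)) are integrable over (0,T) × ℝ^d, that u₀ − v₀ ∈ L¹(ℝ^d), and that t ↦ u(t,·) − v(t,·) is continuous from [0,T] into L¹(ℝ^d). Then the L¹-contraction property holds: for every t ∈ [0,T], ∫_{ℝ^d} |u(t,x) − v(t,x)| dx ≤ ∫_{ℝ^d} |u₀(x) − v₀(x)| dx. -/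

import Mathlib

open Set MeasureTheory Function Filter Topology
open scoped RealInnerProductSpace

/-- The classical divergence `Σ_i ∂_{x_i} g_i (x)` of a vector field on `ℝ^d`. -/
noncomputable def divg {d : ℕ} (g : EuclideanSpace ℝ (Fin d) → EuclideanSpace ℝ (Fin d))
    (x : EuclideanSpace ℝ (Fin d)) : ℝ :=
  ∑ i, fderiv ℝ g x (EuclideanSpace.single i 1) i

/-- The classical Laplacian `Σ_i ∂²_{x_i x_i} φ (x)` of a scalar field on `ℝ^d`. -/
noncomputable def lap {d : ℕ} (φ : EuclideanSpace ℝ (Fin d) → ℝ)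
    (x : EuclideanSpace ℝ (Fin d)) : ℝ :=
  ∑ i, fderiv ℝ (fun y => fderiv ℝ φ y (EuclideanSpace.single i 1)) x (EuclideanSpace.single i 1)

lemma aux_div_ibp {d : ℕ} (ψ : EuclideanSpace ℝ (Fin d) → ℝ)
    (V : EuclideanSpace ℝ (Fin d) → EuclideanSpace ℝ (Fin d))
    (hψ : ContDiff ℝ 1 ψ) (hc : HasCompactSupport ψ) (hV : ContDiff ℝ 1 V) :
    ∫ x, ψ x * divg V x = - ∫ x, fderiv ℝ ψ x (V x) := by
  have hψ' : Continuous (fderiv ℝ ψ) := hψ.continuous_fderiv (by norm_num)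
  have hV' : Continuous (fderiv ℝ V) := hV.continuous_fderiv (by norm_num)
  have hcV : ∀ i, Continuous fun x => (V x) i := fun i => by
    have := hV.continuous; fun_prop
  have hVi : ∀ i x, HasFDerivAt (fun y => V y i)
      ((EuclideanSpace.proj i : EuclideanSpace ℝ (Fin d) →L[ℝ] ℝ).comp (fderiv ℝ V x)) x := by
    intro i x
    exact (EuclideanSpace.proj i : EuclideanSpace ℝ (Fin d) →L[ℝ] ℝ).hasFDerivAt.comp x
      ((hV.differentiable (by norm_num)) x).hasFDerivAt
  have h1 : ∀ i : Fin d, Integrable (fun x => ψ x * fderiv ℝ V x (EuclideanSpace.single i 1) i) := by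
    intro i
    apply Continuous.integrable_of_hasCompactSupport
    · have := hψ.continuous
      fun_prop
    · exact hc.mul_right
  have h2 : ∀ i : Fin d, Integrable (fun x => fderiv ℝ ψ x (EuclideanSpace.single i 1) * V x i) := by
    intro i
    apply Continuous.integrable_of_hasCompactSupport
    · have := hV.continuous
      fun_prop
    · exact (hc.fderiv_apply ℝ _).mul_right
  have h3 : ∀ i : Fin d, Integrable (fun x => ψ x * V x i) := by
    intro i
    apply Continuous.integrable_of_hasCompactSupport
    · have := hψ.continuous
      exact this.mul (hcV i)
    · exact hc.mul_right
  have key : ∀ i : Fin d, ∫ x, ψ x * fderiv ℝ V x (EuclideanSpace.single i 1) i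
      = - ∫ x, fderiv ℝ ψ x (EuclideanSpace.single i 1) * V x i := by
    intro i
    exact integral_bilinear_hasFDerivAt_right_eq_neg_left_of_integrable
      (B := ContinuousLinearMap.mul ℝ ℝ) (f := ψ) (f' := fderiv ℝ ψ) (g := fun y => V y i)
      (g' := fun x => (EuclideanSpace.proj i : EuclideanSpace ℝ (Fin d) →L[ℝ] ℝ).comp (fderiv ℝ V x))
      (v := EuclideanSpace.single i 1) (h2 i) (h1 i) (h3 i)
      (fun x _ => ((hψ.differentiable (by norm_num)) x).hasFDerivAt) (fun x _ => hVi i x)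
  have e1 : ∀ x, ψ x * divg V x = ∑ i, ψ x * fderiv ℝ V x (EuclideanSpace.single i 1) i := by
    intro x; simp [divg, Finset.mul_sum]
  have e2 : ∀ x, fderiv ℝ ψ x (V x) = ∑ i, fderiv ℝ ψ x (EuclideanSpace.single i 1) * V x i := by
    intro x
    conv_lhs => rw [← (EuclideanSpace.basisFun (Fin d) ℝ).sum_repr (V x)]
    simp [mul_comm]
  simp_rw [e1, e2]
  rw [integral_finsetSum _ (fun i _ => h1 i), integral_finsetSum _ (fun i _ => h2 i)]
  simp [key]

lemma aux_beta_deriv (δ : ℝ) (hδ : 0 < δ) (r : ℝ) :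
    HasDerivAt (fun r => √(r ^ 2 + δ ^ 2)) (r / √(r ^ 2 + δ ^ 2)) r := by
  have h : HasDerivAt (fun r : ℝ => r ^ 2 + δ ^ 2) (2 * r) r := by
    simpa using (hasDerivAt_pow 2 r).add_const (δ ^ 2)
  have := h.sqrt (by positivity)
  convert this using 1
  field_simp

lemma aux_beta_deriv2 (δ : ℝ) (hδ : 0 < δ) (r : ℝ) :
    HasDerivAt (fun r => r / √(r ^ 2 + δ ^ 2)) (δ ^ 2 / √(r ^ 2 + δ ^ 2) ^ 3) r := by
  have hp : 0 < r ^ 2 + δ ^ 2 := by positivity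
  have hs : √(r ^ 2 + δ ^ 2) ^ 2 = r ^ 2 + δ ^ 2 := Real.sq_sqrt hp.le
  have hs0 : 0 < √(r ^ 2 + δ ^ 2) := by positivity
  have e : δ ^ 2 / √(r ^ 2 + δ ^ 2) ^ 3
      = (1 * √(r ^ 2 + δ ^ 2) - r * (r / √(r ^ 2 + δ ^ 2))) / √(r ^ 2 + δ ^ 2) ^ 2 := by
    revert hs hs0
    generalize √(r ^ 2 + δ ^ 2) = s
    intro hs hs0
    field_simp
    rw [hs]
    ring
  rw [e]
  exact (hasDerivAt_id r).div (aux_beta_deriv δ hδ r) (by positivity)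

lemma aux_beta_abs (δ : ℝ) (_hδ : 0 < δ) (r : ℝ) : |r / √(r ^ 2 + δ ^ 2)| ≤ 1 := by
  rw [abs_div, abs_of_nonneg (Real.sqrt_nonneg _)]
  apply div_le_one_of_le₀ _ (Real.sqrt_nonneg _)
  apply Real.abs_le_sqrt
  nlinarith [sq_nonneg δ]

lemma aux_beta2_bound (δ : ℝ) (hδ : 0 < δ) (r : ℝ) :
    δ ^ 2 / √(r ^ 2 + δ ^ 2) ^ 3 * r ^ 2 ≤ δ := by
  have hp : 0 < r ^ 2 + δ ^ 2 := by positivity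
  have hs : √(r ^ 2 + δ ^ 2) ^ 2 = r ^ 2 + δ ^ 2 := Real.sq_sqrt hp.le
  have hs0 : 0 < √(r ^ 2 + δ ^ 2) := by positivity
  have hs1 : δ ≤ √(r ^ 2 + δ ^ 2) := Real.le_sqrt_of_sq_le (by nlinarith [sq_nonneg r])
  generalize √(r ^ 2 + δ ^ 2) = s at *
  rw [div_mul_eq_mul_div, div_le_iff₀ (by positivity)]
  have : r ^ 2 ≤ s ^ 2 := by nlinarith
  calc δ ^ 2 * r ^ 2 ≤ δ ^ 2 * s ^ 2 := by gcongr
    _ = δ * (δ * s ^ 2) := by ring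
    _ ≤ δ * (s * s ^ 2) := by gcongr
    _ = _ := by ring

lemma aux_lap_eq {d : ℕ} (w : EuclideanSpace ℝ (Fin d) → ℝ) (hw : ContDiff ℝ 2 w) :
    ContDiff ℝ 1 (gradient w) ∧ ∀ x, lap w x = divg (gradient w) x := by
  have hd : ContDiff ℝ 1 (fderiv ℝ w) := hw.fderiv_right (by norm_num)
  have hg : ContDiff ℝ 1 (gradient w) := by
    exact (InnerProductSpace.toDual ℝ (EuclideanSpace ℝ (Fin d))).symm.toContinuousLinearEquiv.contDiff.comp hd
  refine ⟨hg, fun x => ?_⟩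
  unfold lap divg
  refine Finset.sum_congr rfl fun i _ => ?_
  have e : (fun y => fderiv ℝ w y (EuclideanSpace.single i 1)) = fun y => gradient w y i := by
    funext y
    rw [← inner_gradient_left]
    rw [EuclideanSpace.inner_single_right]
    simp
  rw [e]
  have := ((EuclideanSpace.proj i : EuclideanSpace ℝ (Fin d) →L[ℝ] ℝ).hasFDerivAt.comp x
      ((hg.differentiable (by norm_num)) x).hasFDerivAt).fderiv
  have e2 : fderiv ℝ (fun y => gradient w y i) x = ((EuclideanSpace.proj i : EuclideanSpace ℝ (Fin d) →L[ℝ] ℝ).comp (fderiv ℝ (gradient w) x)) := this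
  rw [e2]; rfl

lemma aux_divg_sub {d : ℕ} (a b : EuclideanSpace ℝ (Fin d) → EuclideanSpace ℝ (Fin d))
    (x : EuclideanSpace ℝ (Fin d)) (ha : DifferentiableAt ℝ a x) (hb : DifferentiableAt ℝ b x) :
    divg (fun y => a y - b y) x = divg a x - divg b x := by
  unfold divg
  rw [fderiv_fun_sub ha hb]
  simp

lemma aux_divg_smul {d : ℕ} (c : ℝ) (a : EuclideanSpace ℝ (Fin d) → EuclideanSpace ℝ (Fin d))
    (x : EuclideanSpace ℝ (Fin d)) (ha : DifferentiableAt ℝ a x) :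
    divg (fun y => c • a y) x = c * divg a x := by
  unfold divg
  rw [fderiv_fun_const_smul ha]
  simp [Finset.mul_sum]

lemma aux_spatial {d : ℕ} (ε δ L : ℝ) (hε : 0 < ε) (hδ : 0 < δ)
    (w φ : EuclideanSpace ℝ (Fin d) → ℝ)
    (G : EuclideanSpace ℝ (Fin d) → EuclideanSpace ℝ (Fin d))
    (hw : ContDiff ℝ 2 w) (hG : ContDiff ℝ 1 G) (hφ : ContDiff ℝ 1 φ) (hc : HasCompactSupport φ)
    (hφ0 : ∀ x, 0 ≤ φ x) (hGL : ∀ x ∈ tsupport φ, ‖G x‖ ≤ L * |w x|) :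
    ∫ x, φ x * (w x / √(w x ^ 2 + δ ^ 2)) * (ε * lap w x - divg G x)
      ≤ L ^ 2 * δ / (4 * ε) * (∫ x, φ x)
        + ∫ x, (ε * ‖gradient w x‖ + ‖G x‖) * ‖fderiv ℝ φ x‖ := by
  obtain ⟨hgr, hlap⟩ := aux_lap_eq w hw
  have hw1 : ContDiff ℝ 1 w := hw.of_le (by norm_num)
  have hβ : ContDiff ℝ 1 (fun x => w x / √(w x ^ 2 + δ ^ 2)) := by
    apply hw1.div
    · apply ContDiff.sqrt
      · fun_prop
      · intro x; positivity
    · intro x; positivity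
  set ψ : EuclideanSpace ℝ (Fin d) → ℝ := fun x => φ x * (w x / √(w x ^ 2 + δ ^ 2)) with hψdef
  have hψ : ContDiff ℝ 1 ψ := hφ.mul hβ
  have hψc : HasCompactSupport ψ := hc.mul_right
  set V : EuclideanSpace ℝ (Fin d) → EuclideanSpace ℝ (Fin d) := fun x => ε • gradient w x - G x with hVdef
  have hV : ContDiff ℝ 1 V := (hgr.const_smul ε).sub hG
  have hdV : ∀ x, ε * lap w x - divg G x = divg V x := by
    intro x
    rw [hVdef, aux_divg_sub (fun y => ε • gradient w y) _ _ ((hgr.differentiable (by norm_num) x).const_smul ε)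
      (hG.differentiable (by norm_num) x), aux_divg_smul _ _ _ (hgr.differentiable (by norm_num) x),
      hlap]
  have e1 : ∫ x, φ x * (w x / √(w x ^ 2 + δ ^ 2)) * (ε * lap w x - divg G x)
      = ∫ x, ψ x * divg V x := by
    simp_rw [hdV]; rfl
  rw [e1, aux_div_ibp ψ V hψ hψc hV, ← integral_neg, ← integral_const_mul, ← integral_add]
  rotate_left
  · exact (hφ.continuous.integrable_of_hasCompactSupport hc).const_mul _
  · apply Continuous.integrable_of_hasCompactSupport
    · have := hgr.continuous
      have := hG.continuous
      have := hφ.continuous_fderiv (by norm_num)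
      fun_prop
    · exact (hc.fderiv ℝ).norm.mul_left
  apply integral_mono
  · apply Integrable.neg
    apply Continuous.integrable_of_hasCompactSupport
    · exact (hψ.continuous_fderiv (by norm_num)).clm_apply hV.continuous
    · apply (hψc.fderiv ℝ).mono
      intro x hx
      contrapose! hx
      simp at hx ⊢
      simp [hx]
  · apply Integrable.add
    · exact (hφ.continuous.integrable_of_hasCompactSupport hc).const_mul _
    · apply Continuous.integrable_of_hasCompactSupport
      · have := hgr.continuous
        have := hG.continuous
        have := hφ.continuous_fderiv (by norm_num)
        fun_prop
      · exact (hc.fderiv ℝ).norm.mul_left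
  intro x
  have hDw := (hw1.differentiable (by norm_num) x).hasFDerivAt
  have hDφ := (hφ.differentiable (by norm_num) x).hasFDerivAt
  have hDψ := (hDφ.mul ((aux_beta_deriv2 δ hδ (w x)).comp_hasFDerivAt x hDw)).fderiv
  have hDψ' : fderiv ℝ ψ x (V x) = φ x * (δ ^ 2 / √(w x ^ 2 + δ ^ 2) ^ 3 * fderiv ℝ w x (V x))
      + w x / √(w x ^ 2 + δ ^ 2) * fderiv ℝ φ x (V x) := by
    change fderiv ℝ ψ x = _ at hDψ
    rw [hDψ]
    simp
  show -(fderiv ℝ ψ x (V x)) ≤ L ^ 2 * δ / (4 * ε) * φ x + (ε * ‖gradient w x‖ + ‖G x‖) * ‖fderiv ℝ φ x‖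
  rw [hDψ']
  have hVn : ‖V x‖ ≤ ε * ‖gradient w x‖ + ‖G x‖ := by
    refine (norm_sub_le _ _).trans ?_
    rw [norm_smul, Real.norm_of_nonneg hε.le]
  have b1 : -(w x / √(w x ^ 2 + δ ^ 2) * fderiv ℝ φ x (V x)) ≤ (ε * ‖gradient w x‖ + ‖G x‖) * ‖fderiv ℝ φ x‖ := by
    refine (neg_le_abs _).trans ?_
    rw [abs_mul]
    calc _ ≤ 1 * |fderiv ℝ φ x (V x)| := by
          gcongr; exact aux_beta_abs δ hδ _
      _ ≤ ‖fderiv ℝ φ x‖ * ‖V x‖ := by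
          rw [one_mul]; exact (fderiv ℝ φ x).le_opNorm _
      _ ≤ ‖fderiv ℝ φ x‖ * (ε * ‖gradient w x‖ + ‖G x‖) := by gcongr
      _ = _ := mul_comm _ _
  have b2 : -(φ x * (δ ^ 2 / √(w x ^ 2 + δ ^ 2) ^ 3 * fderiv ℝ w x (V x))) ≤ L ^ 2 * δ / (4 * ε) * φ x := by
    by_cases hx : x ∈ tsupport φ
    swap
    · rw [image_eq_zero_of_notMem_tsupport hx]; simp
    have hGx := hGL x hx
    have hlow : - (L ^ 2 * w x ^ 2 / (4 * ε)) ≤ fderiv ℝ w x (V x) := by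
      rw [← inner_gradient_left]
      simp only [hVdef, inner_sub_right, inner_smul_right, real_inner_self_eq_norm_sq]
      have := real_inner_le_norm (gradient w x) (G x)
      have h2 : ‖gradient w x‖ * ‖G x‖ ≤ ‖gradient w x‖ * (L * |w x|) := by gcongr
      have h3 : L ^ 2 * w x ^ 2 / (4 * ε) = (L * |w x|) ^ 2 / (4 * ε) := by
        rw [mul_pow, sq_abs]
      rw [h3]
      have h4 : ‖gradient w x‖ * (L * |w x|) ≤ ε * ‖gradient w x‖ ^ 2 + (L * |w x|) ^ 2 / (4 * ε) := by
        have : 0 ≤ (2 * ε * ‖gradient w x‖ - L * |w x|) ^ 2 / (4 * ε) := by positivity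
        have e : (2 * ε * ‖gradient w x‖ - L * |w x|) ^ 2 / (4 * ε) = ε * ‖gradient w x‖ ^ 2 + (L * |w x|) ^ 2 / (4 * ε) - ‖gradient w x‖ * (L * |w x|) := by
          field_simp; ring
        linarith
      linarith
    have hb0 : 0 ≤ δ ^ 2 / √(w x ^ 2 + δ ^ 2) ^ 3 := by positivity
    have hb := aux_beta2_bound δ hδ (w x)
    calc _ = φ x * (δ ^ 2 / √(w x ^ 2 + δ ^ 2) ^ 3 * (-fderiv ℝ w x (V x))) := by ring
      _ ≤ φ x * (δ ^ 2 / √(w x ^ 2 + δ ^ 2) ^ 3 * (L ^ 2 * w x ^ 2 / (4 * ε))) := by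
        have := hφ0 x
        gcongr
        linarith
      _ = φ x * ((L ^ 2 / (4 * ε)) * (δ ^ 2 / √(w x ^ 2 + δ ^ 2) ^ 3 * w x ^ 2)) := by ring
      _ ≤ φ x * ((L ^ 2 / (4 * ε)) * δ) := by
        have := hφ0 x
        gcongr
      _ = _ := by ring
  linarith

lemma aux_time_delta {d : ℕ} (T ε δ L C : ℝ) (hε : 0 < ε) (hδ : 0 < δ)
    (w : ℝ → EuclideanSpace ℝ (Fin d) → ℝ)
    (G : ℝ → EuclideanSpace ℝ (Fin d) → EuclideanSpace ℝ (Fin d))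
    (φ : EuclideanSpace ℝ (Fin d) → ℝ)
    (hwC2 : ContDiffOn ℝ 2 (fun q : ℝ × EuclideanSpace ℝ (Fin d) => w q.1 q.2) (Ioo 0 T ×ˢ univ))
    (hwx : ∀ t ∈ Ioo 0 T, ContDiff ℝ 2 (w t))
    (hG : ∀ t ∈ Ioo 0 T, ContDiff ℝ 1 (G t))
    (hφ : ContDiff ℝ 1 φ) (hc : HasCompactSupport φ) (hφ0 : ∀ x, 0 ≤ φ x)
    (hφC : ∀ x, ‖fderiv ℝ φ x‖ ≤ C)
    (hGL : ∀ t ∈ Ioo 0 T, ∀ x ∈ tsupport φ, ‖G t x‖ ≤ L * |w t x|)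
    (hpde : ∀ t ∈ Ioo 0 T, ∀ x, deriv (fun s => w s x) t = ε * lap (w t) x - divg (G t) x)
    (hint : IntegrableOn (fun q : ℝ × EuclideanSpace ℝ (Fin d) =>
      ε * ‖gradient (w q.1) q.2‖ + ‖G q.1 q.2‖) (Ioo 0 T ×ˢ univ))
    (s t : ℝ) (hs : 0 < s) (hst : s ≤ t) (ht : t < T) :
    ∫ x, φ x * √(w t x ^ 2 + δ ^ 2) ≤ (∫ x, φ x * √(w s x ^ 2 + δ ^ 2))
      + (t - s) * (L ^ 2 * δ / (4 * ε) * (∫ x, φ x))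
      + C * ∫ q in Ioo 0 T ×ˢ (univ : Set (EuclideanSpace ℝ (Fin d))),
          (ε * ‖gradient (w q.1) q.2‖ + ‖G q.1 q.2‖) := by
  have hsub : Icc s t ⊆ Ioo 0 T := fun τ hτ => ⟨hs.trans_le hτ.1, hτ.2.trans_lt ht⟩
  have hsm : s ∈ Ioo 0 T := hsub ⟨le_rfl, hst⟩
  have htm : t ∈ Ioo 0 T := hsub ⟨hst, le_rfl⟩
  have hopen : IsOpen (Ioo 0 T ×ˢ (univ : Set (EuclideanSpace ℝ (Fin d)))) := isOpen_Ioo.prod isOpen_univ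
  have hder : ∀ τ ∈ Ioo 0 T, ∀ x, HasDerivAt (fun s => w s x)
      (fderiv ℝ (fun q : ℝ × EuclideanSpace ℝ (Fin d) => w q.1 q.2) (τ, x) (1, 0)) τ := by
    intro τ hτ x
    have h1 := ((hwC2.differentiableOn (by norm_num)).differentiableAt
      (hopen.mem_nhds (show (τ, x) ∈ _ from ⟨hτ, mem_univ _⟩))).hasFDerivAt
    have h2 : HasDerivAt (fun s : ℝ => (s, x)) ((1 : ℝ), (0 : EuclideanSpace ℝ (Fin d))) τ :=
      (hasDerivAt_id τ).prodMk (hasDerivAt_const τ x)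
    exact h1.comp_hasDerivAt τ h2
  set P : ℝ → EuclideanSpace ℝ (Fin d) → ℝ := fun τ x =>
    φ x * (w τ x / √(w τ x ^ 2 + δ ^ 2)) * deriv (fun s => w s x) τ with hP
  have hPc : ContinuousOn (uncurry P) (Ioo 0 T ×ˢ univ) := by
    have c1 := hwC2.continuousOn
    have c2 : ContinuousOn (fun q : ℝ × EuclideanSpace ℝ (Fin d) => deriv (fun s => w s q.2) q.1)
        (Ioo 0 T ×ˢ univ) := by
      have := (hwC2.continuousOn_fderiv_of_isOpen hopen (by norm_num)).clm_apply
        (continuousOn_const (c := ((1 : ℝ), (0 : EuclideanSpace ℝ (Fin d)))))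
      refine this.congr fun q hq => ?_
      exact (hder q.1 hq.1 q.2).deriv
    have c3 : ContinuousOn (fun q : ℝ × EuclideanSpace ℝ (Fin d) => φ q.2) (Ioo 0 T ×ˢ univ) :=
      (hφ.continuous.comp continuous_snd).continuousOn
    refine (c3.mul (c1.div ?_ ?_)).mul c2
    · exact ((c1.pow 2).add continuousOn_const).sqrt
    · intro q _; positivity
  have hPint : Integrable (uncurry P) ((volume.restrict (Ioc s t)).prod volume) := by
    have i1 : IntegrableOn (uncurry P) (Icc s t ×ˢ tsupport φ) (volume.prod volume) :=
      (hPc.mono (prod_mono hsub (subset_univ _))).integrableOn_compact (isCompact_Icc.prod hc)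
    have i2 : IntegrableOn (uncurry P) (Icc s t ×ˢ univ) (volume.prod volume) := by
      refine i1.of_forall_sdiff_eq_zero (measurableSet_Icc.prod MeasurableSet.univ) ?_
      rintro ⟨τ, x⟩ ⟨h1, h2⟩
      have : x ∉ tsupport φ := fun h => h2 ⟨h1.1, h⟩
      simp [uncurry, hP, image_eq_zero_of_notMem_tsupport this]
    have i3 := i2.mono_set (prod_mono (Ioc_subset_Icc_self (a := s) (b := t)) (subset_univ univ))
    rw [IntegrableOn, ← Measure.prod_restrict, Measure.restrict_univ] at i3
    exact i3
  have hφi : ∀ τ ∈ Ioo 0 T, Integrable (fun x => φ x * √(w τ x ^ 2 + δ ^ 2)) := by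
    intro τ hτ
    apply Continuous.integrable_of_hasCompactSupport
    · have := (hwx τ hτ).continuous
      have := hφ.continuous
      fun_prop
    · exact hc.mul_right
  have hftc : ∀ x, ∫ τ in Ioc s t, P τ x = φ x * √(w t x ^ 2 + δ ^ 2) - φ x * √(w s x ^ 2 + δ ^ 2) := by
    intro x
    rw [← intervalIntegral.integral_of_le hst]
    apply intervalIntegral.integral_eq_sub_of_hasDerivAt (f := fun τ => φ x * √(w τ x ^ 2 + δ ^ 2))
    · intro τ hτ
      rw [uIcc_of_le hst] at hτ
      have h1 := hder τ (hsub hτ) x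
      have h2 := ((aux_beta_deriv δ hδ (w τ x)).comp τ h1).const_mul (φ x)
      rw [← h1.deriv, ← mul_assoc] at h2
      exact h2
    · apply ContinuousOn.intervalIntegrable
      rw [uIcc_of_le hst]
      exact hPc.comp (f := fun τ => (τ, x)) (by fun_prop) (fun τ hτ => ⟨hsub hτ, mem_univ _⟩)
  have hswap := integral_integral_swap hPint
  have hLHS : ∫ x, ∫ τ in Ioc s t, P τ x = (∫ x, φ x * √(w t x ^ 2 + δ ^ 2)) - ∫ x, φ x * √(w s x ^ 2 + δ ^ 2) := by
    simp_rw [hftc]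
    exact integral_sub (hφi t htm) (hφi s hsm)
  set h : ℝ × EuclideanSpace ℝ (Fin d) → ℝ := fun q => ε * ‖gradient (w q.1) q.2‖ + ‖G q.1 q.2‖ with hh
  have hh0 : ∀ q, 0 ≤ h q := fun q => by positivity
  have hDφc : Continuous (fderiv ℝ φ) := hφ.continuous_fderiv (by norm_num)
  have hki : IntegrableOn (fun q => h q * ‖fderiv ℝ φ q.2‖) (Ioo 0 T ×ˢ univ) := by
    refine hint.mul_bdd (c := C) ?_ ?_
    · exact ((hDφc.comp continuous_snd).norm).aestronglyMeasurable
    · filter_upwards with q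
      rw [norm_norm]; exact hφC _
  have hki' := hki.mono_set (prod_mono ((Ioc_subset_Icc_self (a := s) (b := t)).trans hsub) (subset_univ univ))
  have hki2 : Integrable (fun q => h q * ‖fderiv ℝ φ q.2‖) ((volume.restrict (Ioc s t)).prod volume) := by
    have := hki'
    rw [IntegrableOn, Measure.volume_eq_prod, ← Measure.prod_restrict, Measure.restrict_univ] at this
    exact this
  have hkbound : ∫ τ in Ioc s t, ∫ x, h (τ, x) * ‖fderiv ℝ φ x‖ ≤ C * ∫ q in Ioo 0 T ×ˢ (univ : Set (EuclideanSpace ℝ (Fin d))), h q := by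
    have e := integral_prod _ hki2
    have e' : ∫ q, h q * ‖fderiv ℝ φ q.2‖ ∂((volume.restrict (Ioc s t)).prod volume)
        = ∫ q in Ioc s t ×ˢ univ, h q * ‖fderiv ℝ φ q.2‖ := by
      rw [Measure.volume_eq_prod, ← Measure.prod_restrict, Measure.restrict_univ]
    rw [← e, e']
    calc _ ≤ ∫ q in Ioo 0 T ×ˢ univ, h q * ‖fderiv ℝ φ q.2‖ := by
          apply setIntegral_mono_set hki
          · filter_upwards with q
            exact mul_nonneg (hh0 q) (norm_nonneg _)
          · exact (prod_mono ((Ioc_subset_Icc_self (a := s) (b := t)).trans hsub) (subset_univ univ)).eventuallyLE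
      _ ≤ ∫ q in Ioo 0 T ×ˢ univ, C * h q := by
          apply integral_mono hki (hint.const_mul C)
          intro q
          show h q * ‖fderiv ℝ φ q.2‖ ≤ C * h q
          rw [mul_comm C]
          exact mul_le_mul_of_nonneg_left (hφC _) (hh0 q)
      _ = _ := integral_const_mul _ _
  have hmain : ∫ τ in Ioc s t, ∫ x, P τ x ≤ ∫ τ in Ioc s t, ((L ^ 2 * δ / (4 * ε) * (∫ x, φ x))
        + ∫ x, h (τ, x) * ‖fderiv ℝ φ x‖) := by
    apply setIntegral_mono_on hPint.integral_prod_left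
    · exact (integrable_const _).add hki2.integral_prod_left
    · exact measurableSet_Ioc
    · intro τ hτ
      have hτ' := hsub (Ioc_subset_Icc_self hτ)
      have := aux_spatial ε δ L hε hδ (w τ) φ (G τ) (hwx τ hτ') (hG τ hτ') hφ hc hφ0 (hGL τ hτ')
      simp_rw [← hpde τ hτ'] at this
      exact this
  have hsplit : ∫ τ in Ioc s t, ((L ^ 2 * δ / (4 * ε) * (∫ x, φ x))
        + ∫ x, h (τ, x) * ‖fderiv ℝ φ x‖) = (t - s) * (L ^ 2 * δ / (4 * ε) * (∫ x, φ x))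
        + ∫ τ in Ioc s t, ∫ x, h (τ, x) * ‖fderiv ℝ φ x‖ := by
    rw [integral_add (integrable_const _) hki2.integral_prod_left]
    simp [hst]
  linarith

lemma aux_time {d : ℕ} (T ε L C : ℝ) (hε : 0 < ε)
    (w : ℝ → EuclideanSpace ℝ (Fin d) → ℝ)
    (G : ℝ → EuclideanSpace ℝ (Fin d) → EuclideanSpace ℝ (Fin d))
    (φ : EuclideanSpace ℝ (Fin d) → ℝ)
    (hwC2 : ContDiffOn ℝ 2 (fun q : ℝ × EuclideanSpace ℝ (Fin d) => w q.1 q.2) (Ioo 0 T ×ˢ univ))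
    (hwx : ∀ t ∈ Ioo 0 T, ContDiff ℝ 2 (w t))
    (hG : ∀ t ∈ Ioo 0 T, ContDiff ℝ 1 (G t))
    (hφ : ContDiff ℝ 1 φ) (hc : HasCompactSupport φ) (hφ0 : ∀ x, 0 ≤ φ x)
    (hφC : ∀ x, ‖fderiv ℝ φ x‖ ≤ C)
    (hGL : ∀ t ∈ Ioo 0 T, ∀ x ∈ tsupport φ, ‖G t x‖ ≤ L * |w t x|)
    (hpde : ∀ t ∈ Ioo 0 T, ∀ x, deriv (fun s => w s x) t = ε * lap (w t) x - divg (G t) x)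
    (hint : IntegrableOn (fun q : ℝ × EuclideanSpace ℝ (Fin d) =>
      ε * ‖gradient (w q.1) q.2‖ + ‖G q.1 q.2‖) (Ioo 0 T ×ˢ univ))
    (s t : ℝ) (hs : 0 < s) (hst : s ≤ t) (ht : t < T) :
    ∫ x, φ x * |w t x| ≤ (∫ x, φ x * |w s x|)
      + C * ∫ q in Ioo 0 T ×ˢ (univ : Set (EuclideanSpace ℝ (Fin d))),
          (ε * ‖gradient (w q.1) q.2‖ + ‖G q.1 q.2‖) := by
  have hsm : s ∈ Ioo 0 T := ⟨hs, hst.trans_lt ht⟩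
  have htm : t ∈ Ioo 0 T := ⟨hs.trans_le hst, ht⟩
  have hφi := hφ.continuous.integrable_of_hasCompactSupport hc (μ := volume)
  have hφint : 0 ≤ ∫ x, φ x := integral_nonneg hφ0
  set D : ℝ := (∫ x, φ x) + (t - s) * (L ^ 2 / (4 * ε) * (∫ x, φ x)) with hD
  have hD0 : 0 ≤ D := by
    have : 0 ≤ t - s := by linarith
    positivity
  have hi1 : ∀ τ ∈ Ioo 0 T, Integrable (fun x => φ x * |w τ x|) := by
    intro τ hτ
    apply Continuous.integrable_of_hasCompactSupport
    · have := (hwx τ hτ).continuous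
      have := hφ.continuous
      fun_prop
    · exact hc.mul_right
  have hi2 : ∀ δ : ℝ, ∀ τ ∈ Ioo 0 T, Integrable (fun x => φ x * √(w τ x ^ 2 + δ ^ 2)) := by
    intro δ τ hτ
    apply Continuous.integrable_of_hasCompactSupport
    · have := (hwx τ hτ).continuous
      have := hφ.continuous
      fun_prop
    · exact hc.mul_right
  apply le_of_forall_pos_le_add
  intro η hη
  set δ : ℝ := η / (D + 1) with hδd
  have hδ : 0 < δ := by positivity
  have hδD : δ * D ≤ η := by
    rw [hδd, div_mul_eq_mul_div, div_le_iff₀ (by positivity)]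
    nlinarith
  have key := aux_time_delta T ε δ L C hε hδ w G φ hwC2 hwx hG hφ hc hφ0 hφC hGL hpde hint s t hs hst ht
  have k1 : ∫ x, φ x * |w t x| ≤ ∫ x, φ x * √(w t x ^ 2 + δ ^ 2) := by
    apply integral_mono (hi1 t htm) (hi2 δ t htm)
    intro x
    apply mul_le_mul_of_nonneg_left _ (hφ0 x)
    apply Real.abs_le_sqrt
    nlinarith [sq_nonneg δ]
  have k2 : ∫ x, φ x * √(w s x ^ 2 + δ ^ 2) ≤ (∫ x, φ x * |w s x|) + δ * ∫ x, φ x := by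
    rw [← integral_const_mul, ← integral_add (hi1 s hsm) (hφi.const_mul δ)]
    apply integral_mono (hi2 δ s hsm) ((hi1 s hsm).add (hφi.const_mul δ))
    intro x
    show φ x * √(w s x ^ 2 + δ ^ 2) ≤ φ x * |w s x| + δ * φ x
    have : √(w s x ^ 2 + δ ^ 2) ≤ |w s x| + δ := by
      apply Real.sqrt_le_iff.2 ⟨by positivity, ?_⟩
      nlinarith [sq_abs (w s x), abs_nonneg (w s x)]
    calc _ ≤ φ x * (|w s x| + δ) := mul_le_mul_of_nonneg_left this (hφ0 x)
      _ = _ := by ring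
  have k3 : δ * D = δ * (∫ x, φ x) + (t - s) * (L ^ 2 * δ / (4 * ε) * (∫ x, φ x)) := by
    rw [hD]; ring
  linarith

lemma aux_cutoff (d : ℕ) : ∃ (C : ℝ) (φ : ℕ → EuclideanSpace ℝ (Fin d) → ℝ), ∀ n,
    ContDiff ℝ 1 (φ n) ∧ HasCompactSupport (φ n) ∧ (∀ x, 0 ≤ φ n x) ∧ (∀ x, φ n x ≤ 1) ∧
    (∀ x, ‖fderiv ℝ (φ n) x‖ ≤ C / ((n : ℝ) + 1)) ∧ (∀ x, ‖x‖ ≤ (n : ℝ) + 1 → φ n x = 1) := by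
  let f : ContDiffBump (0 : EuclideanSpace ℝ (Fin d)) := ⟨1, 2, by norm_num, by norm_num⟩
  have hf : ContDiff ℝ 1 f := f.contDiff
  obtain ⟨C, hC⟩ := (f.hasCompactSupport.fderiv ℝ).exists_bound_of_continuous
    (hf.continuous_fderiv (by norm_num))
  refine ⟨C, fun n x => f (((n : ℝ) + 1)⁻¹ • x), fun n => ?_⟩
  have hn : (0 : ℝ) < (n : ℝ) + 1 := by positivity
  refine ⟨?_, ?_, fun x => f.nonneg, fun x => f.le_one, fun x => ?_, fun x hx => ?_⟩
  · exact hf.comp (contDiff_id.const_smul _)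
  · exact f.hasCompactSupport.comp_smul (by positivity)
  · have h1 : HasFDerivAt (fun x : EuclideanSpace ℝ (Fin d) => ((n : ℝ) + 1)⁻¹ • x)
      (((n : ℝ) + 1)⁻¹ • ContinuousLinearMap.id ℝ (EuclideanSpace ℝ (Fin d))) x :=
      (((n : ℝ) + 1)⁻¹ • ContinuousLinearMap.id ℝ (EuclideanSpace ℝ (Fin d))).hasFDerivAt
    have h2 := ((hf.differentiable (by norm_num) (((n : ℝ) + 1)⁻¹ • x)).hasFDerivAt.comp x h1).fderiv
    change fderiv ℝ (fun x => f (((n : ℝ) + 1)⁻¹ • x)) x = _ at h2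
    rw [h2, ContinuousLinearMap.comp_smul, ContinuousLinearMap.comp_id, norm_smul,
      Real.norm_of_nonneg (by positivity), div_eq_inv_mul]
    exact mul_le_mul_of_nonneg_left (hC _) (by positivity)
  · apply f.one_of_mem_closedBall
    rw [mem_closedBall_zero_iff, norm_smul, Real.norm_of_nonneg (by positivity)]
    show _ ≤ (1 : ℝ)
    rw [inv_mul_le_iff₀ hn]; linarith

lemma aux_lipschitz {d : ℕ} (g : EuclideanSpace ℝ (Fin d) → ℝ → EuclideanSpace ℝ (Fin d))
    (hg : ContDiff ℝ 1 (fun p : EuclideanSpace ℝ (Fin d) × ℝ => g p.1 p.2))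
    (K : Set (EuclideanSpace ℝ (Fin d))) (hK : IsCompact K) (M : ℝ) :
    ∃ L, ∀ x ∈ K, ∀ a b : ℝ, |a| ≤ M → |b| ≤ M → ‖g x a - g x b‖ ≤ L * |a - b| := by
  obtain ⟨L, hL⟩ := (hK.prod (isCompact_Icc (a := -M) (b := M))).exists_bound_of_continuousOn
    (hg.continuous_fderiv (by norm_num)).continuousOn
  refine ⟨L, fun x hx a b ha hb => ?_⟩
  have hconv : Convex ℝ ({x} ×ˢ Icc (-M) M : Set (EuclideanSpace ℝ (Fin d) × ℝ)) :=
    (convex_singleton x).prod (convex_Icc _ _)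
  have := hconv.norm_image_sub_le_of_norm_fderiv_le (𝕜 := ℝ) (C := L)
    (f := fun p : EuclideanSpace ℝ (Fin d) × ℝ => g p.1 p.2) (x := (x, b)) (y := (x, a))
    (fun p _ => hg.differentiable (by norm_num) p)
    (fun p hp => hL p ⟨by rw [show p.1 = x from hp.1]; exact hx, hp.2⟩)
    ⟨rfl, abs_le.1 hb⟩ ⟨rfl, abs_le.1 ha⟩
  simpa [Prod.norm_def] using this

/-- **`L¹`-contraction for the parabolic (vanishing viscosity) approximation.**
For bounded `C²` classical solutions `u, v` of `∂_t w + div_x 𝔤(x,w) = ε Δ w` on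
`(0,T) × ℝ^d`, continuous up to `t = 0, T`, with suitable integrability and with
`t ↦ u(t,·) − v(t,·)` continuous into `L¹`, one has
`∫ |u(t) − v(t)| dx ≤ ∫ |u₀ − v₀| dx` for every `t ∈ [0,T]`. -/
theorem l1_contraction_viscous
    (d : ℕ) (hd : 1 ≤ d) (T ε : ℝ) (hT : 0 < T) (hε : 0 < ε)
    (g : EuclideanSpace ℝ (Fin d) → ℝ → EuclideanSpace ℝ (Fin d))
    (hg : ContDiff ℝ 1 (fun p : EuclideanSpace ℝ (Fin d) × ℝ => g p.1 p.2))
    (u v : ℝ → EuclideanSpace ℝ (Fin d) → ℝ)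
    (u₀ v₀ : EuclideanSpace ℝ (Fin d) → ℝ)
    (hubd : ∃ M, ∀ t ∈ Ioo (0 : ℝ) T, ∀ x, |u t x| ≤ M)
    (hvbd : ∃ M, ∀ t ∈ Ioo (0 : ℝ) T, ∀ x, |v t x| ≤ M)
    (huC2 : ContDiffOn ℝ 2 (fun q : ℝ × EuclideanSpace ℝ (Fin d) => u q.1 q.2)
      (Ioo 0 T ×ˢ univ))
    (hvC2 : ContDiffOn ℝ 2 (fun q : ℝ × EuclideanSpace ℝ (Fin d) => v q.1 q.2)
      (Ioo 0 T ×ˢ univ))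
    (hucont : ContinuousOn (fun q : ℝ × EuclideanSpace ℝ (Fin d) => u q.1 q.2)
      (Icc 0 T ×ˢ univ))
    (hvcont : ContinuousOn (fun q : ℝ × EuclideanSpace ℝ (Fin d) => v q.1 q.2)
      (Icc 0 T ×ˢ univ))
    (hueq : ∀ t ∈ Ioo (0 : ℝ) T, ∀ x,
      deriv (fun s => u s x) t + divg (fun y => g y (u t y)) x = ε * lap (u t) x)
    (hveq : ∀ t ∈ Ioo (0 : ℝ) T, ∀ x,
      deriv (fun s => v s x) t + divg (fun y => g y (v t y)) x = ε * lap (v t) x)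
    (hu0 : ∀ x, u 0 x = u₀ x) (hv0 : ∀ x, v 0 x = v₀ x)
    (hdiffInt : IntegrableOn (fun q : ℝ × EuclideanSpace ℝ (Fin d) => u q.1 q.2 - v q.1 q.2)
      (Ioo 0 T ×ˢ univ))
    (hgradInt : IntegrableOn
      (fun q : ℝ × EuclideanSpace ℝ (Fin d) => gradient (fun y => u q.1 y - v q.1 y) q.2)
      (Ioo 0 T ×ˢ univ))
    (hfluxInt : IntegrableOn
      (fun q : ℝ × EuclideanSpace ℝ (Fin d) => g q.2 (u q.1 q.2) - g q.2 (v q.1 q.2))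
      (Ioo 0 T ×ˢ univ))
    (h0Int : Integrable (fun x => u₀ x - v₀ x))
    (hL1cont : ∀ t₀ ∈ Icc (0 : ℝ) T,
      Tendsto (fun t => ∫ x, |(u t x - v t x) - (u t₀ x - v t₀ x)|)
        (nhdsWithin t₀ (Icc 0 T)) (nhds 0)) :
    ∀ t ∈ Icc (0 : ℝ) T, ∫ x, |u t x - v t x| ≤ ∫ x, |u₀ x - v₀ x| := by
  classical
  intro t₀ ht₀
  by_cases hwi : Integrable (fun x => u t₀ x - v t₀ x)
  swap
  · have : ¬ Integrable (fun x => |u t₀ x - v t₀ x|) := by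
      intro h
      apply hwi
      have hm : AEStronglyMeasurable (fun x => u t₀ x - v t₀ x) volume := by
        have h1 : Continuous (fun x => u t₀ x) := by
          rw [← continuousOn_univ]
          exact hucont.comp (f := fun x => (t₀, x)) (by fun_prop) (fun x _ => ⟨ht₀, mem_univ _⟩)
        have h2 : Continuous (fun x => v t₀ x) := by
          rw [← continuousOn_univ]
          exact hvcont.comp (f := fun x => (t₀, x)) (by fun_prop) (fun x _ => ⟨ht₀, mem_univ _⟩)
        exact (h1.sub h2).aestronglyMeasurable
      exact (integrable_norm_iff hm).1 h
    rw [integral_undef this]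
    exact integral_nonneg fun x => abs_nonneg _
  obtain ⟨Mu, hMu⟩ := hubd
  obtain ⟨Mv, hMv⟩ := hvbd
  set w : ℝ → EuclideanSpace ℝ (Fin d) → ℝ := fun t x => u t x - v t x with hw
  set G : ℝ → EuclideanSpace ℝ (Fin d) → EuclideanSpace ℝ (Fin d) :=
    fun t x => g x (u t x) - g x (v t x) with hGd
  have hopen : IsOpen (Ioo 0 T ×ˢ (univ : Set (EuclideanSpace ℝ (Fin d)))) := isOpen_Ioo.prod isOpen_univ
  have slice : ∀ f : ℝ → EuclideanSpace ℝ (Fin d) → ℝ,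
      ContDiffOn ℝ 2 (fun q : ℝ × EuclideanSpace ℝ (Fin d) => f q.1 q.2) (Ioo 0 T ×ˢ univ) →
      ∀ t ∈ Ioo 0 T, ContDiff ℝ 2 (f t) := by
    intro f hf t ht
    rw [← contDiffOn_univ]
    exact hf.comp (f := fun x => (t, x)) (by fun_prop) (fun x _ => ⟨ht, mem_univ _⟩)
  have tdiff : ∀ f : ℝ → EuclideanSpace ℝ (Fin d) → ℝ,
      ContDiffOn ℝ 2 (fun q : ℝ × EuclideanSpace ℝ (Fin d) => f q.1 q.2) (Ioo 0 T ×ˢ univ) →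
      ∀ t ∈ Ioo 0 T, ∀ x, DifferentiableAt ℝ (fun s => f s x) t := by
    intro f hf t ht x
    have h1 := (hf.differentiableOn (by norm_num)).differentiableAt
      (hopen.mem_nhds (show (t, x) ∈ _ from ⟨ht, mem_univ _⟩))
    exact h1.comp (f := fun s => (s, x)) t (by fun_prop)
  have hgslice : ∀ f : EuclideanSpace ℝ (Fin d) → ℝ, ContDiff ℝ 2 f →
      ContDiff ℝ 1 (fun y => g y (f y)) := by
    intro f hf
    exact hg.comp (contDiff_id.prodMk (hf.of_le (by norm_num)))
  have hwC2 : ContDiffOn ℝ 2 (fun q : ℝ × EuclideanSpace ℝ (Fin d) => w q.1 q.2) (Ioo 0 T ×ˢ univ) :=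
    huC2.sub hvC2
  have hwx := slice w hwC2
  have hG : ∀ t ∈ Ioo 0 T, ContDiff ℝ 1 (G t) := fun t ht =>
    (hgslice _ (slice u huC2 t ht)).sub (hgslice _ (slice v hvC2 t ht))
  have hpde : ∀ t ∈ Ioo 0 T, ∀ x, deriv (fun s => w s x) t = ε * lap (w t) x - divg (G t) x := by
    intro t ht x
    have hu2 := slice u huC2 t ht
    have hv2 := slice v hvC2 t ht
    have e1 : deriv (fun s => w s x) t = deriv (fun s => u s x) t - deriv (fun s => v s x) t :=
      deriv_fun_sub (tdiff u huC2 t ht x) (tdiff v hvC2 t ht x)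
    have e2 : divg (G t) x = divg (fun y => g y (u t y)) x - divg (fun y => g y (v t y)) x :=
      aux_divg_sub _ _ x ((hgslice _ hu2).differentiable (by norm_num) x)
        ((hgslice _ hv2).differentiable (by norm_num) x)
    have e3 : lap (w t) x = lap (u t) x - lap (v t) x := by
      rw [(aux_lap_eq _ (hwx t ht)).2, (aux_lap_eq _ hu2).2, (aux_lap_eq _ hv2).2,
        ← aux_divg_sub _ _ x ((aux_lap_eq _ hu2).1.differentiable (by norm_num) x)
          ((aux_lap_eq _ hv2).1.differentiable (by norm_num) x)]
      congr 1
      funext y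
      have : fderiv ℝ (w t) y = fderiv ℝ (u t) y - fderiv ℝ (v t) y :=
        fderiv_fun_sub (hu2.differentiable (by norm_num) y) (hv2.differentiable (by norm_num) y)
      simp only [gradient]
      rw [this, map_sub]
    have := hueq t ht x
    have := hveq t ht x
    rw [e1, e2, e3]
    linarith
  have hint : IntegrableOn (fun q : ℝ × EuclideanSpace ℝ (Fin d) =>
      ε * ‖gradient (w q.1) q.2‖ + ‖G q.1 q.2‖) (Ioo 0 T ×ˢ univ) :=
    (hgradInt.norm.const_mul ε).add hfluxInt.norm
  set J : ℝ := ∫ q in Ioo 0 T ×ˢ (univ : Set (EuclideanSpace ℝ (Fin d))),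
          (ε * ‖gradient (w q.1) q.2‖ + ‖G q.1 q.2‖) with hJ
  obtain ⟨C, φ, hφ⟩ := aux_cutoff d
  have hbound : ∀ n, ∫ x, φ n x * |w t₀ x| ≤ (∫ x, |u₀ x - v₀ x|) + C / ((n : ℝ) + 1) * J := by
    intro n
    obtain ⟨hφ1, hφc, hφ0, hφle, hφC, -⟩ := hφ n
    obtain ⟨L, hL⟩ := aux_lipschitz g hg (tsupport (φ n)) hφc (max Mu Mv)
    have hGL : ∀ t ∈ Ioo 0 T, ∀ x ∈ tsupport (φ n), ‖G t x‖ ≤ L * |w t x| := fun t ht x hx =>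
      hL x hx _ _ ((hMu t ht x).trans (le_max_left _ _)) ((hMv t ht x).trans (le_max_right _ _))
    have key := aux_time T ε L (C / ((n : ℝ) + 1)) hε w G (φ n) hwC2 hwx hG hφ1 hφc hφ0 hφC hGL hpde hint
    set Φ : ℝ → ℝ := fun t => ∫ x, φ n x * |w t x| with hΦ
    have hΦc : ContinuousOn Φ (Icc 0 T) := by
      apply continuousOn_integral_of_compact_support (k := tsupport (φ n)) hφc
      · have c1 : ContinuousOn (fun q : ℝ × EuclideanSpace ℝ (Fin d) => w q.1 q.2) (Icc 0 T ×ˢ univ) :=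
          hucont.sub hvcont
        exact (hφ1.continuous.comp continuous_snd).continuousOn.mul c1.abs
      · intro t x _ hx
        simp [image_eq_zero_of_notMem_tsupport hx]
    have s1 : ∀ t ∈ Ioo 0 T, Φ t ≤ Φ 0 + C / ((n : ℝ) + 1) * J := by
      intro t ht
      have hl : Tendsto Φ (𝓝[Ioo 0 t] 0) (𝓝 (Φ 0)) :=
        (hΦc 0 ⟨le_rfl, hT.le⟩).mono_left (nhdsWithin_mono _ fun s hs => ⟨hs.1.le, (hs.2.trans ht.2).le⟩)
      haveI : (𝓝[Ioo 0 t] (0 : ℝ)).NeBot := by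
        rw [nhdsWithin_Ioo_eq_nhdsGT ht.1]; infer_instance
      refine ge_of_tendsto (hl.add_const (C / ((n : ℝ) + 1) * J)) ?_
      filter_upwards [self_mem_nhdsWithin] with s hs
      exact key s t hs.1 hs.2.le ht.2
    have s2 : Φ t₀ ≤ Φ 0 + C / ((n : ℝ) + 1) * J := by
      have hne : (𝓝[Ioo 0 T] t₀).NeBot := by
        rw [← mem_closure_iff_nhdsWithin_neBot, closure_Ioo hT.ne]
        exact ht₀
      have hl : Tendsto Φ (𝓝[Ioo 0 T] t₀) (𝓝 (Φ t₀)) :=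
        (hΦc t₀ ht₀).mono_left (nhdsWithin_mono _ Ioo_subset_Icc_self)
      refine le_of_tendsto hl ?_
      filter_upwards [self_mem_nhdsWithin] with s hs
      exact s1 s hs
    have s3 : Φ 0 ≤ ∫ x, |u₀ x - v₀ x| := by
      apply integral_mono_of_nonneg
      · filter_upwards with x
        exact mul_nonneg (hφ0 x) (abs_nonneg _)
      · exact h0Int.abs
      · filter_upwards with x
        show φ n x * |u 0 x - v 0 x| ≤ |u₀ x - v₀ x|
        rw [hu0, hv0]
        exact mul_le_of_le_one_left (abs_nonneg _) (hφle x)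
    linarith
  have hlim1 : Tendsto (fun n => ∫ x, φ n x * |w t₀ x|) atTop (𝓝 (∫ x, |w t₀ x|)) := by
    apply tendsto_integral_of_dominated_convergence (fun x => |w t₀ x|)
    · intro n
      exact (hφ n).1.continuous.aestronglyMeasurable.mul hwi.abs.aestronglyMeasurable
    · exact hwi.abs
    · intro n
      filter_upwards with x
      rw [norm_mul, Real.norm_of_nonneg ((hφ n).2.2.1 x), Real.norm_of_nonneg (abs_nonneg _)]
      exact mul_le_of_le_one_left (abs_nonneg _) ((hφ n).2.2.2.1 x)
    · filter_upwards with x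
      apply tendsto_const_nhds.congr'
      obtain ⟨N, hN⟩ := exists_nat_ge ‖x‖
      filter_upwards [eventually_ge_atTop N] with n hn
      have : (N : ℝ) ≤ n := by exact_mod_cast hn
      rw [(hφ n).2.2.2.2.2 x (by linarith), one_mul]
  have hlim2 : Tendsto (fun n : ℕ => (∫ x, |u₀ x - v₀ x|) + C / ((n : ℝ) + 1) * J) atTop
      (𝓝 ((∫ x, |u₀ x - v₀ x|) + 0 * J)) := by
    have h : Tendsto (fun n : ℕ => C / ((n : ℝ) + 1)) atTop (𝓝 0) :=
      tendsto_const_nhds.div_atTop (tendsto_atTop_add_const_right _ _ tendsto_natCast_atTop_atTop)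
    exact (h.mul_const J).const_add _
  have := le_of_tendsto_of_tendsto' hlim1 hlim2 hbound
  simpa using this
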